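/- For every integer n ≥ 3, if k = A(n) is the smallest positive integer such that n+k+1 divides p = (k+1)n + k(k+1)/2, then the quotient q_n = p/(n+k+1) equals τ(n-1), the smallest positive integer q such that T_{n-1} + T_q is a triangular number. -/

import Mathlib

/-- The triangular number `T m = m(m+1)/2`. -/
def T (m : ℕ) : ℕ := m * (m + 1) / 2

theorem two_mul_T (m : ℕ) : 2 * T m = m * (m + 1) :=
  Nat.mul_div_cancel' (Nat.even_mul_succ_self m).two_dvd

theorem T_add_T_eq_T_iff (a q m : ℕ) :
    T a + T q = T m ↔ a * (a + 1) + q * (q + 1) = m * (m + 1) := by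
  rw [← two_mul_T a, ← two_mul_T q, ← two_mul_T m]
  omega

/-- Twice the sum `n + (n + 1) + ⋯ + (n + k)`. -/
theorem two_mul_sum_consecutive (n k : ℕ) :
    2 * ((k + 1) * n + k * (k + 1) / 2) = (k + 1) * (2 * n + k) := by
  have h := two_mul_T k
  unfold T at h
  rw [mul_add, h]
  ring

theorem sum_consecutive_eq_mul_iff (n k q : ℕ) :
    (k + 1) * n + k * (k + 1) / 2 = (n + k + 1) * q ↔
      (k + 1) * (2 * n + k) = 2 * ((n + k + 1) * q) := by
  rw [← two_mul_sum_consecutive]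
  omega

/-- The quotient `(n + ⋯ + (n + k)) / (n + k + 1)` is monotone in `k`. -/
theorem quotient_le_quotient {n k l q r : ℕ} (hkl : k ≤ l)
    (hq : (k + 1) * (2 * n + k) = 2 * ((n + k + 1) * q))
    (hr : (l + 1) * (2 * n + l) = 2 * ((n + l + 1) * r)) : q ≤ r := by
  by_contra! hlt
  obtain ⟨d, rfl⟩ := Nat.exists_eq_add_of_le hkl
  have hqn : 2 * q ≤ n + k := by
    by_contra! h
    nlinarith [Nat.mul_le_mul_left (n + k + 1) h, Nat.le_mul_self n]
  nlinarith [Nat.mul_le_mul_left (n + (k + d) + 1) (Nat.succ_le_of_lt hlt),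
    Nat.mul_le_mul_left d hqn]

/-- For `n ≥ 3`, if `k = A(n)` is the smallest positive integer such that
`n+k+1` divides `p = (k+1)n + k(k+1)/2`, then the quotient `q_n = p/(n+k+1)` equals
`τ(n-1)`, the smallest positive `q` such that `T (n-1) + T q` is a triangular number. -/
theorem qn_eq_tau (n k : ℕ) (hn : 3 ≤ n)
    (hk : IsLeast {k : ℕ | 0 < k ∧ (n + k + 1) ∣ ((k + 1) * n + k * (k + 1) / 2)} k) :
    IsLeast {q : ℕ | 0 < q ∧ ∃ m : ℕ, T (n - 1) + T q = T m}
      (((k + 1) * n + k * (k + 1) / 2) / (n + k + 1)) := by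
  obtain ⟨⟨-, q, hq⟩, hmin⟩ := hk
  rw [hq, Nat.mul_div_cancel_left q (by omega)]
  rw [sum_consecutive_eq_mul_iff] at hq
  obtain ⟨a, rfl⟩ : ∃ a, n = a + 1 := ⟨n - 1, by omega⟩
  rw [Nat.add_sub_cancel]
  refine ⟨⟨Nat.pos_of_ne_zero ?_, a + 1 + k - q, ?_⟩, ?_⟩
  · rintro rfl
    simp at hq
  · have hle : q ≤ a + 1 + k := by
      by_contra! h
      nlinarith [Nat.mul_le_mul_left (a + 1 + k + 1) h]
    obtain ⟨m, hm⟩ := Nat.exists_eq_add_of_le hle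
    rw [T_add_T_eq_T_iff, hm, Nat.add_sub_cancel_left]
    zify at hq hm ⊢
    rw [show (m : ℤ) = a + 1 + k - q by linarith]
    linarith
  · rintro r ⟨hr, m, hm⟩
    rw [T_add_T_eq_T_iff] at hm
    have ham : a < m := by
      by_contra! h
      nlinarith [Nat.mul_le_mul h h]
    obtain ⟨l, hl⟩ := Nat.exists_eq_add_of_le (show a + 1 ≤ m + r by omega)
    have hlr : (l + 1) * (2 * (a + 1) + l) = 2 * ((a + 1 + l + 1) * r) := by
      zify at hm hl ⊢
      rw [show (m : ℤ) = a + 1 + l - r by linarith] at hm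
      linarith
    exact quotient_le_quotient
      (hmin ⟨by omega, r, (sum_consecutive_eq_mul_iff _ _ _).2 hlr⟩) hq hlr
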